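/- Let s ≥ 1, let u = (u₁,…,u_s) ∈ ℕ^s, and let f : [0,1]^s → ℝ be a function whose mixed partial derivatives up to order u_i in each variable x_i are continuous on [0,1]^s. Let 1 ≤ p ≤ ∞, let ∅ ≠ v ⊆ S = {1,…,s}, and let k_v = (k_i)_{i∈v} ∈ ℕ^{|v|}, where k_i = ∑_{j=1}^{N_i} 2^{a_{i,j}} with a_{i,1} > ⋯ > a_{i,N_i} ≥ 0. Then |f̂((k_v;0))| ≤ 2^{|v|/p} · 2^{−μ'_u((k_v;0))} · ‖f^{(min(u,N_{k_v}))}‖_p < ∞, where min(u, N_{k_v}) denotes the multi-index (min(u_i, N_i))_{i∈v}. -/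

import Mathlib

open MeasureTheory Finset
open scoped ENNReal

noncomputable section

/-- The `j`-th binary digit (`j ≥ 1`) of a real number `x ∈ [0,1)`
(using the binary expansion in which infinitely many digits are `0`). -/
def bdigit (x : ℝ) (j : ℕ) : ℕ := ⌊x * 2 ^ j⌋.toNat % 2

/-- The `k`-th (dyadic) Walsh function. -/
def walsh (k : ℕ) (x : ℝ) : ℝ :=
  (-1 : ℝ) ^ (∑ j ∈ Finset.range k, if k.testBit j then bdigit x (j + 1) else 0)

/-- The multi-dimensional Walsh function. -/
def walshV {s : ℕ} (k : Fin s → ℕ) (x : Fin s → ℝ) : ℝ := ∏ i, walsh (k i) (x i)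

/-- The half-open unit cube `[0,1)^s`. -/
def unitCube (s : ℕ) : Set (Fin s → ℝ) := Set.univ.pi fun _ => Set.Ico (0 : ℝ) 1

/-- The closed unit cube `[0,1]^s`. -/
def closedCube (s : ℕ) : Set (Fin s → ℝ) := Set.univ.pi fun _ => Set.Icc (0 : ℝ) 1

/-- The `k`-th Walsh coefficient of `f`. -/
def walshCoeff {s : ℕ} (f : (Fin s → ℝ) → ℝ) (k : Fin s → ℕ) : ℝ :=
  ∫ x in unitCube s, f x * walshV k x

/-- `z ⊕ 2^{-n}` : flipping the `n`-th binary digit of `z`. -/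
def oplus (z : ℝ) (n : ℕ) : ℝ := z + (-1) ^ bdigit z n * ((2 : ℝ) ^ n)⁻¹

/-- The dyadic difference `∂_{i,n}`. -/
def dyadicDiff {s : ℕ} (i : Fin s) (n : ℕ) (g : (Fin s → ℝ) → ℝ) (x : Fin s → ℝ) : ℝ :=
  2 ^ n * (g (Function.update x i (oplus (x i) n)) - g x)

/-- The function `χ_n`. -/
def chi (n : ℕ) (x y : ℝ) : ℝ :=
  if min x (oplus x n) ≤ y ∧ y ≤ max x (oplus x n) then 2 ^ n else 0

/-- The exponents in the binary expansion of `k`, in decreasing order. -/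
def bitsDesc (k : ℕ) : List ℕ := ((List.range k).filter fun j => k.testBit j).reverse

/-- The number `N` of nonzero binary digits of `k`. -/
def numBits (k : ℕ) : ℕ := (bitsDesc k).length

/-- The weight `μ'_u(k) = ∑_{j=1}^{min(u,N)} (a_j + 2)` for scalar `k`. -/
def muW (u k : ℕ) : ℕ := (((bitsDesc k).take u).map (· + 2)).sum

/-- The weight `μ'_u(k)` for vectors. -/
def muWV {s : ℕ} (u k : Fin s → ℕ) : ℕ := ∑ i, muW (u i) (k i)

/-- `k_{≤}^{u}` : the `u` most significant binary digits of `k`. -/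
def kLe (u k : ℕ) : ℕ := (((bitsDesc k).take u).map (2 ^ ·)).sum

/-- `k_{>}^{u}` : the remaining binary digits of `k`. -/
def kGt (u k : ℕ) : ℕ := (((bitsDesc k).drop u).map (2 ^ ·)).sum

/-- The functions `W(k)`, defined inductively by stripping the least significant
binary digit of `k` (whose exponent is the 2-adic valuation of `k`). -/
def Wfun : ℕ → ℝ → ℝ
  | 0 => fun _ => 1
  | (k + 1) => fun y =>
      ∫ x in Set.Ico (0 : ℝ) 1,
        chi ((k + 1).factorization 2 + 1) x y *
          Wfun ((k + 1) - 2 ^ ((k + 1).factorization 2)) x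
  decreasing_by exact Nat.sub_lt (Nat.succ_pos k) (Nat.two_pow_pos _)

/-- Composition of the dyadic differences `∂_{i,a+1}` for `a` running over a list. -/
def dCompCoord {s : ℕ} (i : Fin s) (L : List ℕ) (g : (Fin s → ℝ) → ℝ) : (Fin s → ℝ) → ℝ :=
  L.foldr (fun a h => dyadicDiff i (a + 1) h) g

/-- The operator `d_{k_u}` : composition over all coordinates `i` of the dyadic
differences `∂_{i,a_{i,j}+1}`, `1 ≤ j ≤ min(u_i, N_i)`. -/
def dComp {s : ℕ} (u k : Fin s → ℕ) (f : (Fin s → ℝ) → ℝ) : (Fin s → ℝ) → ℝ :=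
  (List.finRange s).foldr (fun i g => dCompCoord i ((bitsDesc (k i)).take (u i)) g) f

/-- The multi-index `ν` increased by one in coordinate `i`. -/
def addE {s : ℕ} (i : Fin s) (ν : Fin s → ℕ) : Fin s → ℕ := Function.update ν i (ν i + 1)

/-- `D` is a family of mixed partial derivatives of `f`, of orders up to `u_i` in
the variable `x_i`, each continuous on the closed cube `[0,1]^s`. -/
def HasMixedDerivs {s : ℕ} (u : Fin s → ℕ) (f : (Fin s → ℝ) → ℝ)
    (D : (Fin s → ℕ) → (Fin s → ℝ) → ℝ) : Prop :=
  D (fun _ => 0) = f ∧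
    (∀ ν : Fin s → ℕ, (∀ j, ν j ≤ u j) → ContinuousOn (D ν) (closedCube s)) ∧
    ∀ (ν : Fin s → ℕ) (i : Fin s), (∀ j, addE i ν j ≤ u j) →
      ∀ x ∈ closedCube s,
        HasDerivWithinAt (fun t => D ν (Function.update x i t)) (D (addE i ν) x)
          (Set.Icc 0 1) (x i)

/-- `∫_{[0,1)^{s-|v|}} F dx_{S∖v}` : the inner integral over the coordinates outside `v`
(as a function of the coordinates in `v`). -/
def projInt {s : ℕ} (v : Finset (Fin s)) (F : (Fin s → ℝ) → ℝ) (x : Fin s → ℝ) : ℝ :=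
  ∫ y in unitCube s, F fun i => if i ∈ v then x i else y i

/-- The mixed norm `‖F^{(·)}‖_p` : the `L^p` norm (over the coordinates in `v`) of the
integral of `F` over the coordinates outside `v`. -/
def mixedNorm {s : ℕ} (p : ℝ≥0∞) (v : Finset (Fin s)) (F : (Fin s → ℝ) → ℝ) : ℝ≥0∞ :=
  eLpNorm (projInt v F) p (volume.restrict (unitCube s))

/-- The `ℓ^q` norm of a finite family in `ℝ≥0∞`, with the usual modification at `q = ∞`. -/
def lqNorm {ι : Type*} [Fintype ι] (q : ℝ≥0∞) (a : ι → ℝ≥0∞) : ℝ≥0∞ :=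
  if q = ∞ then ⨆ i, a i else (∑ i, a i ^ q.toReal) ^ q.toReal⁻¹

/-- The `h`-th point of the digital net generated by the matrices `C i`. -/
def netPoint {s m n : ℕ} (C : Fin s → Matrix (Fin n) (Fin m) (ZMod 2)) (h : Fin (2 ^ m)) :
    Fin s → ℝ :=
  fun i => ∑ j : Fin n,
    (((∑ l : Fin m, (if (h : ℕ).testBit (l : ℕ) then (1 : ZMod 2) else 0) * C i j l).val : ℝ) *
      ((2 : ℝ) ^ ((j : ℕ) + 1))⁻¹)

/-- Membership of `k ∈ ℕ₀^s` in the dual net `P^⊥`. -/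
def inDual {s m n : ℕ} (C : Fin s → Matrix (Fin n) (Fin m) (ZMod 2)) (k : Fin s → ℕ) : Prop :=
  ∀ l : Fin m, ∑ i, ∑ j : Fin n, C i j l * (if (k i).testBit (j : ℕ) then (1 : ZMod 2) else 0) = 0

open Classical in
/-- `∑_{k_v ∈ P_v^⊥} 2^{-μ'_α(k_v)}`, encoded as a sum over all `k ∈ ℕ₀^s`
with support exactly `v` lying in the dual net. -/
def dualSum {s m n : ℕ} (α : ℕ) (C : Fin s → Matrix (Fin n) (Fin m) (ZMod 2))
    (v : Finset (Fin s)) : ℝ≥0∞ :=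
  ∑' k : Fin s → ℕ,
    if (∀ i, i ∈ v ↔ k i ≠ 0) ∧ inDual C k
    then (2 : ℝ≥0∞) ^ (-(muWV (fun _ => α) k : ℝ)) else 0


/-- Measurable `r`-periodic functions of mean `M` with values in `[0, 2 * M]`. -/
structure Tent (r M : ℝ) (T : ℝ → ℝ) : Prop where
  meas : Measurable T
  nonneg : ∀ x, 0 ≤ T x
  le : ∀ x, T x ≤ 2 * M
  per : Function.Periodic T r
  int : ∫ x in (0 : ℝ)..r, T x = r * M

lemma intervalIntegrable_of_measurable_of_abs_le {h : ℝ → ℝ} (hm : Measurable h) {C : ℝ}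
    (hC : ∀ x, |h x| ≤ C) (a b : ℝ) : IntervalIntegrable h volume a b :=
  (intervalIntegrable_const (c := C)).mono_fun' hm.aestronglyMeasurable
    (Filter.Eventually.of_forall fun x => by simpa using hC x)

lemma Tent.one (r : ℝ) : Tent r 1 (fun _ => 1) where
  meas := measurable_const
  nonneg _ := zero_le_one
  le _ := by norm_num
  per _ := rfl
  int := by simp

lemma Tent.abs_le {r M : ℝ} {T : ℝ → ℝ} (h : Tent r M T) (x : ℝ) : |T x| ≤ 2 * M := by
  rw [abs_of_nonneg (h.nonneg x)]; exact h.le x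

lemma Tent.nat_mul {r M : ℝ} {T : ℝ → ℝ} (h : Tent r M T) (n : ℕ) : Tent (n * r) M T where
  meas := h.meas
  nonneg := h.nonneg
  le := h.le
  per := h.per.nat_mul n
  int := by
    have := h.per.intervalIntegral_add_zsmul_eq n 0
      (intervalIntegrable_of_measurable_of_abs_le h.meas h.abs_le)
    simp only [zero_add, zsmul_eq_mul, Int.cast_natCast, h.int] at this
    rw [this, mul_assoc]

/-- The primitive of a tent function multiplied by a square wave of twice its period. -/
lemma Tent.primitive {c M : ℝ} (hc : 0 < c) {T ρ : ℝ → ℝ} (hT : Tent c M T)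
    (hρm : Measurable ρ) (hρ : ∀ x, |ρ x| = 1) (hanti : Function.Antiperiodic ρ c)
    (hone : ∀ x ∈ Set.Ico 0 c, ρ x = 1) :
    Tent (2 * c) (c * M / 2) (fun x => ∫ t in (0 : ℝ)..x, ρ t * T t) := by
  set P : ℝ → ℝ := fun x => ∫ t in (0 : ℝ)..x, ρ t * T t with hP
  have hII : ∀ a b, IntervalIntegrable (fun t => ρ t * T t) volume a b :=
    intervalIntegrable_of_measurable_of_abs_le (hρm.mul hT.meas) (C := 2 * M)
      fun x => by rw [abs_mul, hρ, one_mul]; exact hT.abs_le x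
  have hIT : ∀ a b, IntervalIntegrable T volume a b :=
    intervalIntegrable_of_measurable_of_abs_le hT.meas hT.abs_le
  have hcont : Continuous P := intervalIntegral.continuous_primitive hII 0
  have hlow : ∀ x ∈ Set.Icc 0 c, P x = ∫ t in (0 : ℝ)..x, T t := by
    intro x hx
    refine intervalIntegral.integral_congr_ae ?_
    have : ∀ᵐ t : ℝ, t ≠ c := by simp [ae_iff, measure_singleton]
    filter_upwards [this] with t ht hmem
    rw [Set.uIoc_of_le hx.1] at hmem
    rw [hone t ⟨hmem.1.le, lt_of_le_of_ne (hmem.2.trans hx.2) ht⟩, one_mul]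
  have hPc : P c = c * M := by rw [hlow c ⟨hc.le, le_rfl⟩, hT.int]
  have hshift : ∀ x, P (x + c) = c * M - P x := by
    intro x
    have h1 : P (x + c) = P c + ∫ t in c..(x + c), ρ t * T t :=
      (intervalIntegral.integral_add_adjacent_intervals (hII _ _) (hII _ _)).symm
    have h2 : ∫ t in c..(x + c), ρ t * T t = ∫ t in (0 : ℝ)..x, ρ (t + c) * T (t + c) := by
      rw [intervalIntegral.integral_comp_add_right (fun t => ρ t * T t), zero_add]
    rw [h1, h2, hPc]
    simp only [hanti _, hT.per _, neg_mul, intervalIntegral.integral_neg, hP]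
    ring
  have hper : Function.Periodic P (2 * c) := by
    intro x
    rw [show x + 2 * c = (x + c) + c by ring, hshift, hshift]; ring
  have hbase : ∀ x ∈ Set.Ico 0 c, 0 ≤ P x ∧ P x ≤ c * M := by
    intro x hx
    rw [hlow x ⟨hx.1, hx.2.le⟩]
    refine ⟨intervalIntegral.integral_nonneg hx.1 fun t _ => hT.nonneg t, ?_⟩
    rw [← hT.int, ← intervalIntegral.integral_add_adjacent_intervals (hIT 0 x) (hIT x c)]
    have := intervalIntegral.integral_nonneg (μ := volume) hx.2.le fun t _ => hT.nonneg t
    linarith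
  have hrange : ∀ x, 0 ≤ P x ∧ P x ≤ c * M := by
    intro x
    obtain ⟨y, hy, hxy⟩ := hper.exists_mem_Ico₀ (by linarith : 0 < 2 * c) x
    rw [hxy]
    rcases lt_or_ge y c with h | h
    · exact hbase y ⟨hy.1, h⟩
    · have := hbase (y - c) ⟨by linarith, by linarith [hy.2]⟩
      have h2 := hshift (y - c)
      rw [sub_add_cancel] at h2
      constructor <;> linarith [this.1, this.2]
  refine ⟨hcont.measurable, fun x => (hrange x).1, fun x => by linarith [(hrange x).2], hper, ?_⟩
  rw [← intervalIntegral.integral_add_adjacent_intervals (b := c)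
    (hcont.intervalIntegrable _ _) (hcont.intervalIntegrable _ _)]
  have h2 : ∫ t in c..(2 * c), P t = ∫ t in (0 : ℝ)..c, P (t + c) := by
    rw [intervalIntegral.integral_comp_add_right P, zero_add, two_mul]
  rw [h2]
  simp only [hshift]
  rw [intervalIntegral.integral_sub intervalIntegrable_const (hcont.intervalIntegrable _ _)]
  simp
  ring

/-- If `S` is constant on the intervals `[j * r, (j + 1) * r)` and the primitive of `g` vanishes
at the multiples of `r`, then the primitive of `S * g` is `S` times that of `g`. -/
lemma integral_mul_of_const_on_cells {r : ℝ} (hr : 0 < r) {S g : ℝ → ℝ}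
    (hS : ∀ j : ℕ, ∀ x ∈ Set.Ico (j * r) ((j + 1) * r), S x = S (j * r))
    (hII : ∀ a b, IntervalIntegrable (fun t => S t * g t) volume a b)
    (hg : ∀ a b, IntervalIntegrable g volume a b)
    (h0 : ∀ j : ℕ, ∫ t in (0 : ℝ)..(j * r), g t = 0) {x : ℝ} (hx : 0 ≤ x) :
    ∫ t in (0 : ℝ)..x, S t * g t = S x * ∫ t in (0 : ℝ)..x, g t := by
  have hcell : ∀ j : ℕ, ∀ y ∈ Set.Icc (j * r) ((j + 1) * r),
      ∫ t in (j * r)..y, S t * g t = S (j * r) * ∫ t in (0 : ℝ)..y, g t := by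
    intro j y hy
    have h1 : ∫ t in (j * r)..y, S t * g t = ∫ t in (j * r)..y, S (j * r) * g t := by
      refine intervalIntegral.integral_congr_ae ?_
      have : ∀ᵐ t : ℝ, t ≠ (j + 1) * r := by simp [ae_iff, measure_singleton]
      filter_upwards [this] with t ht hmem
      rw [Set.uIoc_of_le hy.1] at hmem
      rw [hS j t ⟨hmem.1.le, lt_of_le_of_ne (hmem.2.trans hy.2) ht⟩]
    rw [h1, intervalIntegral.integral_const_mul,
      ← intervalIntegral.integral_add_adjacent_intervals (hg 0 (j * r)) (hg (j * r) y), h0, zero_add]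
  have hgrid : ∀ j : ℕ, ∫ t in (0 : ℝ)..(j * r), S t * g t = 0 := by
    intro j
    induction j with
    | zero => simp
    | succ j ih =>
      rw [← intervalIntegral.integral_add_adjacent_intervals (hII 0 (j * r)) (hII (j * r) _), ih,
        hcell j _ ⟨by push_cast; nlinarith, by push_cast; rfl⟩, h0]
      simp
  have hj := Nat.floor_le (div_nonneg hx hr.le)
  have hj' := Nat.lt_floor_add_one (x / r)
  rw [le_div_iff₀ hr] at hj
  rw [div_lt_iff₀ hr] at hj'
  set j := ⌊x / r⌋₊
  rw [← intervalIntegral.integral_add_adjacent_intervals (hII 0 (j * r)) (hII (j * r) x), hgrid,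
    hcell j x ⟨hj, hj'.le⟩, zero_add, hS j x ⟨hj, hj'⟩]

/-- The `a`-th Rademacher function, extended to the real line. -/
def rademacher (a : ℕ) (x : ℝ) : ℝ := (-1) ^ ⌊x * 2 ^ (a + 1)⌋

lemma measurable_rademacher (a : ℕ) : Measurable (rademacher a) := by
  have h : Measurable fun x : ℝ => ⌊x * 2 ^ (a + 1)⌋ :=
    Int.measurable_floor.comp (measurable_id.mul_const _)
  exact (measurable_from_top (f := fun n : ℤ => (-1 : ℝ) ^ n)).comp h

lemma abs_rademacher (a : ℕ) (x : ℝ) : |rademacher a x| = 1 := by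
  simp [rademacher, abs_zpow]

lemma antiperiodic_rademacher (a : ℕ) :
    Function.Antiperiodic (rademacher a) ((2 : ℝ) ^ (a + 1))⁻¹ := by
  intro x
  have : (x + ((2 : ℝ) ^ (a + 1))⁻¹) * 2 ^ (a + 1) = x * 2 ^ (a + 1) + 1 := by
    field_simp
  rw [rademacher, this, Int.floor_add_one, zpow_add_one₀ (by norm_num), rademacher]
  ring

lemma rademacher_eq_one (a : ℕ) {x : ℝ} (hx : x ∈ Set.Ico 0 ((2 : ℝ) ^ (a + 1))⁻¹) :
    rademacher a x = 1 := by
  have : ⌊x * 2 ^ (a + 1)⌋ = 0 := by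
    rw [Int.floor_eq_zero_iff]
    exact ⟨mul_nonneg hx.1 (by positivity), (lt_inv_mul_iff₀' (by positivity)).1 (by simpa using hx.2)⟩
  simp [rademacher, this]

lemma rademacher_const {a b : ℕ} (hab : b < a) (j : ℕ) {x : ℝ}
    (hx : x ∈ Set.Ico (j * ((2 : ℝ) ^ a)⁻¹) ((j + 1) * ((2 : ℝ) ^ a)⁻¹)) :
    rademacher b x = rademacher b (j * ((2 : ℝ) ^ a)⁻¹) := by
  have key : ∀ y ∈ Set.Ico (j * ((2 : ℝ) ^ a)⁻¹) ((j + 1) * ((2 : ℝ) ^ a)⁻¹),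
      ⌊y * 2 ^ (b + 1)⌋ = (j : ℤ) / ((2 ^ (a - (b + 1)) : ℕ) : ℤ) := by
    intro y hy
    have h1 : ⌊y * 2 ^ a⌋ = (j : ℤ) := by
      rw [Int.floor_eq_iff]
      have := hy.1
      have := hy.2
      rw [← div_eq_mul_inv] at *
      rw [div_le_iff₀ (by positivity)] at *
      rw [lt_div_iff₀ (by positivity)] at *
      constructor <;> push_cast <;> linarith
    rw [← h1, ← Int.floor_div_natCast]
    congr 1
    obtain ⟨d, rfl⟩ := Nat.exists_eq_add_of_le (Nat.succ_le_of_lt hab)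
    simp only [Nat.succ_eq_add_one, Nat.add_sub_cancel_left]
    push_cast
    rw [pow_add _ (b + 1) d]
    field_simp
  rw [rademacher, rademacher, key x hx, key _ ⟨le_rfl, ?_⟩]
  gcongr
  linarith

/-- The Walsh function with the binary exponents `L`, extended to the real line. -/
def radProd (L : List ℕ) (x : ℝ) : ℝ := (L.map fun a => rademacher a x).prod

lemma measurable_radProd (L : List ℕ) : Measurable (radProd L) := by
  induction L with
  | nil => exact measurable_const
  | cons a L ih => exact (measurable_rademacher a).mul ih

lemma abs_radProd (L : List ℕ) (x : ℝ) : |radProd L x| = 1 := by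
  induction L with
  | nil => simp [radProd]
  | cons a L ih =>
    simp only [radProd, List.map_cons, List.prod_cons, abs_mul, abs_rademacher, one_mul] at *
    exact ih

lemma radProd_const {a : ℕ} {L : List ℕ} (hL : ∀ b ∈ L, b < a) (j : ℕ) {x : ℝ}
    (hx : x ∈ Set.Ico (j * ((2 : ℝ) ^ a)⁻¹) ((j + 1) * ((2 : ℝ) ^ a)⁻¹)) :
    radProd L x = radProd L (j * ((2 : ℝ) ^ a)⁻¹) := by
  unfold radProd
  congr 1
  exact List.map_congr_left fun b hb => rademacher_const (hL b hb) j hx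

lemma pairwise_bitsDesc (k : ℕ) : (bitsDesc k).Pairwise (· > ·) := by
  rw [bitsDesc, List.pairwise_reverse]
  exact List.Pairwise.filter _ List.pairwise_lt_range

lemma walsh_eq_radProd (k : ℕ) {x : ℝ} (hx : 0 ≤ x) : walsh k x = radProd (bitsDesc k) x := by
  have hd : ∀ j, rademacher j x = (-1 : ℝ) ^ bdigit x (j + 1) := by
    intro j
    have hn : 0 ≤ ⌊x * 2 ^ (j + 1)⌋ := Int.floor_nonneg.2 (by positivity)
    rw [rademacher, bdigit, ← neg_one_pow_eq_pow_mod_two]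
    conv_lhs => rw [← Int.toNat_of_nonneg hn, zpow_natCast]
  rw [walsh, ← Finset.prod_pow_eq_pow_sum, radProd, bitsDesc, List.map_reverse,
    List.prod_reverse, ← List.prod_toFinset]
  · rw [List.toFinset_filter, Finset.prod_filter]
    simp only [List.toFinset_range, hd]
    refine Finset.prod_congr rfl fun j _ => ?_
    split_ifs <;> simp
  · exact List.nodup_range.filter _

/-- Iterated primitives of a product of Rademacher functions, in decreasing order of frequency. -/
lemma exists_iterated_primitives {L : List ℕ} (hL : L.Pairwise (· > ·)) {M : ℝ} {T : ℝ → ℝ}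
    (hT1 : Tent 1 M T) (hT : ∀ b ∈ L, Tent ((2 : ℝ) ^ (b + 1))⁻¹ M T) :
    ∃ J : ℕ → ℝ → ℝ, (∀ x, J 0 x = radProd L x * T x) ∧
      (∀ n ≤ L.length, Measurable (J n) ∧
        (∀ x, |J n x| ≤ 2 * (M * ((2 : ℝ) ^ ((L.take n).map (· + 2)).sum)⁻¹)) ∧
        ∫ x in (0 : ℝ)..1, |J n x| = M * ((2 : ℝ) ^ ((L.take n).map (· + 2)).sum)⁻¹) ∧
      ∀ n < L.length, (∀ x, 0 ≤ x → J (n + 1) x = ∫ t in (0 : ℝ)..x, J n t) ∧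
        J (n + 1) 1 = 0 := by
  induction L generalizing M T with
  | nil =>
    refine ⟨fun _ => T, by simp [radProd], ?_, by simp⟩
    have : ∀ x, |T x| = T x := fun x => abs_of_nonneg (hT1.nonneg x)
    simpa [this, hT1.int] using ⟨hT1.meas, hT1.le⟩
  | cons a L ih =>
    rw [List.pairwise_cons] at hL
    obtain ⟨hLa, hL⟩ := hL
    have hTa := hT a List.mem_cons_self
    set T' : ℝ → ℝ := fun x => ∫ t in (0 : ℝ)..x, rademacher a t * T t with hT'def
    have hT' : ∀ m ≤ a, Tent ((2 : ℝ) ^ m)⁻¹ (M * ((2 : ℝ) ^ (a + 2))⁻¹) T' := by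
      intro m hm
      have := (hTa.primitive (by positivity) (measurable_rademacher a) (abs_rademacher a)
        (antiperiodic_rademacher a) fun x => rademacher_eq_one a).nat_mul (2 ^ (a - m))
      convert this using 1
      · obtain ⟨d, rfl⟩ := Nat.exists_eq_add_of_le hm
        simp only [Nat.add_sub_cancel_left]
        push_cast
        rw [pow_succ, pow_add]
        field_simp
      · rw [pow_succ _ (a + 1)]
        field_simp
    have hT'1 : Tent 1 (M * ((2 : ℝ) ^ (a + 2))⁻¹) T' := by simpa using hT' 0 (Nat.zero_le a)
    obtain ⟨J, hJ0, hJ, hJs⟩ := ih hL hT'1 fun b hb => hT' (b + 1) (hLa b hb)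
    refine ⟨fun n => Nat.casesOn n (fun x => radProd (a :: L) x * T x) J, fun x => rfl, ?_, ?_⟩
    · rintro (_ | n) hn
      · refine ⟨(measurable_radProd _).mul hT1.meas, fun x => ?_, ?_⟩
        · simpa [abs_mul, abs_radProd] using hT1.abs_le x
        · have : ∀ x, |T x| = T x := fun x => abs_of_nonneg (hT1.nonneg x)
          simp [abs_mul, abs_radProd, this, hT1.int]
      · have := hJ n (by simpa using hn)
        simpa [pow_add _ (a + 2), mul_assoc, mul_comm, mul_left_comm] using this
    · rintro (_ | n) hn
      · have hII : ∀ a' b, IntervalIntegrable (fun t => rademacher a t * T t) volume a' b :=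
          intervalIntegrable_of_measurable_of_abs_le ((measurable_rademacher a).mul hT1.meas)
            (C := 2 * M) fun x => by
              rw [abs_mul, abs_rademacher, one_mul]; exact hT1.abs_le x
        have hIS : ∀ a' b, IntervalIntegrable
            (fun t => radProd L t * (rademacher a t * T t)) volume a' b :=
          intervalIntegrable_of_measurable_of_abs_le
            ((measurable_radProd L).mul ((measurable_rademacher a).mul hT1.meas))
            (C := 2 * M) fun x => by
              rw [abs_mul, abs_mul, abs_radProd, abs_rademacher, one_mul, one_mul]
              exact hT1.abs_le x
        have hT'0 : T' 0 = 0 := by simp [hT'def]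
        refine ⟨fun x hx => ?_, ?_⟩
        · have h := integral_mul_of_const_on_cells (r := ((2 : ℝ) ^ a)⁻¹) (by positivity)
            (fun j x hx => radProd_const hLa j hx) hIS hII
            (fun j => by
              have := (hT' a le_rfl).per.nat_mul j 0
              rw [zero_add, hT'0] at this
              exact this) hx
          change J 0 x = _
          rw [hJ0, ← h]
          refine intervalIntegral.integral_congr fun t _ => ?_
          change radProd L t * _ = radProd (a :: L) t * T t
          simp only [radProd, List.map_cons, List.prod_cons]
          ring
        · change J 0 1 = 0
          have := hT'1.per 0
          rw [zero_add, hT'0] at this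
          rw [hJ0, this, mul_zero]
      · exact hJs n (by simpa using hn)

/-- The iterated primitives of a Walsh function. -/
lemma exists_walsh_primitives (k : ℕ) :
    ∃ J : ℕ → ℝ → ℝ, (∀ x, 0 ≤ x → J 0 x = walsh k x) ∧
      (∀ n ≤ numBits k, Measurable (J n) ∧
        (∀ x, |J n x| ≤ 2 * ((2 : ℝ) ^ muW n k)⁻¹) ∧
        ∫ x in (0 : ℝ)..1, |J n x| = ((2 : ℝ) ^ muW n k)⁻¹) ∧
      ∀ n < numBits k, (∀ x, 0 ≤ x → J (n + 1) x = ∫ t in (0 : ℝ)..x, J n t) ∧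
        J (n + 1) 1 = 0 := by
  obtain ⟨J, h0, h1, h2⟩ := exists_iterated_primitives (pairwise_bitsDesc k)
    (Tent.one 1) (fun b _ => Tent.one _)
  refine ⟨J, fun x hx => by rw [h0, walsh_eq_radProd k hx, mul_one], ?_, h2⟩
  simpa only [one_mul, numBits, muW] using h1

lemma integral_mul_eq_neg_of_primitive {g g' h H : ℝ → ℝ}
    (hg : ∀ x ∈ Set.Icc (0 : ℝ) 1, HasDerivWithinAt g (g' x) (Set.Icc 0 1) x)
    (hg' : ContinuousOn g' (Set.Icc 0 1)) (hh : IntervalIntegrable h volume 0 1)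
    (hH : ∀ x ∈ Set.Icc (0 : ℝ) 1, H x = ∫ t in (0 : ℝ)..x, h t) (hH1 : H 1 = 0) :
    ∫ x in (0 : ℝ)..1, g x * h x = -∫ x in (0 : ℝ)..1, g' x * H x := by
  have huI : Set.uIcc (0 : ℝ) 1 = Set.Icc 0 1 := Set.uIcc_of_le zero_le_one
  obtain ⟨C, hC⟩ := isCompact_Icc.exists_bound_of_continuousOn hg'
  have hgac : AbsolutelyContinuousOnInterval g 0 1 := by
    refine LipschitzOnWith.absolutelyContinuousOnInterval (K := C.toNNReal) ?_
    rw [huI]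
    refine Convex.lipschitzOnWith_of_nnnorm_hasDerivWithin_le (convex_Icc _ _) hg fun x hx => ?_
    rw [← NNReal.coe_le_coe, coe_nnnorm]
    exact (hC x hx).trans (Real.le_coe_toNNReal C)
  have hP := hh.absolutelyContinuousOnInterval_intervalIntegral (c := 0) (by simp)
  have key := hgac.integral_mul_deriv_eq_deriv_mul hP
  have hne0 : ∀ᵐ x : ℝ, x ≠ 1 := by simp [ae_iff, measure_singleton]
  have e1 : ∫ x in (0 : ℝ)..1, g x * h x
      = ∫ x in (0 : ℝ)..1, g x * deriv (fun x => ∫ t in (0 : ℝ)..x, h t) x := by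
    refine intervalIntegral.integral_congr_ae ?_
    filter_upwards [hh.ae_hasDerivAt_integral] with x hx hmem
    rw [(hx (Set.uIoc_subset_uIcc hmem) 0 (by simp)).deriv]
  have e2 : ∫ x in (0 : ℝ)..1, g' x * H x
      = ∫ x in (0 : ℝ)..1, deriv g x * ∫ t in (0 : ℝ)..x, h t := by
    refine intervalIntegral.integral_congr_ae ?_
    filter_upwards [hne0] with x hx hmem
    rw [Set.uIoc_of_le zero_le_one] at hmem
    have hm : x ∈ Set.Icc (0 : ℝ) 1 := ⟨hmem.1.le, hmem.2⟩
    rw [hH x hm, ((hg x hm).hasDerivAt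
      (Icc_mem_nhds hmem.1 (lt_of_le_of_ne hmem.2 hx))).deriv]
  rw [e1, e2, key, ← hH 1 (by simp), hH1]
  simp

/-- Lebesgue measure on `[0,1)`. -/
def unitMeasure : Measure ℝ := volume.restrict (Set.Ico 0 1)

instance : IsProbabilityMeasure unitMeasure := ⟨by simp [unitMeasure]⟩

lemma restrict_unitCube (s : ℕ) :
    (volume : Measure (Fin s → ℝ)).restrict (unitCube s) = Measure.pi fun _ => unitMeasure := by
  rw [volume_pi, unitCube, Measure.restrict_pi_pi]; rfl

instance (s : ℕ) : IsProbabilityMeasure ((volume : Measure (Fin s → ℝ)).restrict (unitCube s)) := by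
  rw [restrict_unitCube]; infer_instance

lemma measurableSet_unitCube (s : ℕ) : MeasurableSet (unitCube s) :=
  MeasurableSet.univ_pi fun _ => measurableSet_Ico

lemma unitCube_subset_closedCube (s : ℕ) : unitCube s ⊆ closedCube s :=
  Set.pi_mono fun _ _ => Set.Ico_subset_Icc_self

lemma isCompact_closedCube (s : ℕ) : IsCompact (closedCube s) :=
  isCompact_univ_pi fun _ => isCompact_Icc

lemma integral_unitMeasure (g : ℝ → ℝ) : ∫ x, g x ∂unitMeasure = ∫ x in (0 : ℝ)..1, g x := by
  rw [unitMeasure, integral_Ico_eq_integral_Ioc, intervalIntegral.integral_of_le zero_le_one]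

/-- Merging two independent points coordinatewise preserves a product measure. -/
lemma measurePreserving_merge {ι α : Type*} [Fintype ι] [DecidableEq ι] [MeasurableSpace α]
    (μ : ι → Measure α) [∀ i, IsProbabilityMeasure (μ i)] (v : Finset ι) :
    MeasurePreserving (fun z : (ι → α) × (ι → α) => fun i => if i ∈ v then z.1 i else z.2 i)
      ((Measure.pi μ).prod (Measure.pi μ)) (Measure.pi μ) := by
  have hm : Measurable (fun z : (ι → α) × (ι → α) => fun i => if i ∈ v then z.1 i else z.2 i) := by
    refine measurable_pi_lambda _ fun i => ?_
    split_ifs <;> fun_prop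
  refine ⟨hm, (Measure.pi_eq fun t ht => ?_).symm⟩
  rw [Measure.map_apply hm (MeasurableSet.univ_pi ht)]
  have : (fun z : (ι → α) × (ι → α) => fun i => if i ∈ v then z.1 i else z.2 i) ⁻¹'
      Set.univ.pi t = (Set.univ.pi fun i => if i ∈ v then t i else Set.univ) ×ˢ
        (Set.univ.pi fun i => if i ∈ v then Set.univ else t i) := by
    ext z
    simp only [Set.mem_preimage, Set.mem_prod, Set.mem_univ_pi, ← forall_and]
    refine forall_congr' fun i => ?_
    by_cases hi : i ∈ v <;> simp [hi]
  rw [this, Measure.prod_prod, Measure.pi_pi, Measure.pi_pi, ← Finset.prod_mul_distrib]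
  refine Finset.prod_congr rfl fun i _ => ?_
  by_cases hi : i ∈ v <;> simp [hi]

lemma integral_merge {s : ℕ} (v : Finset (Fin s)) {F : (Fin s → ℝ) → ℝ}
    (hF : IntegrableOn F (unitCube s)) :
    ∫ x in unitCube s, F x =
      ∫ x in unitCube s, ∫ y in unitCube s, F fun i => if i ∈ v then x i else y i := by
  have hmp := measurePreserving_merge (fun _ : Fin s => unitMeasure) v
  rw [IntegrableOn, restrict_unitCube] at hF
  rw [restrict_unitCube]
  have h := integral_map (f := F) hmp.measurable.aemeasurable (by rw [hmp.map_eq]; exact hF.1)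
  rw [hmp.map_eq] at h
  rw [h]
  exact integral_prod _ (hmp.integrable_comp_of_integrable hF)

/-- Integrating one coordinate first. -/
lemma integral_update {s : ℕ} (i : Fin s) {F : (Fin s → ℝ) → ℝ}
    (hF : IntegrableOn F (unitCube s))
    (hFi : ∀ x ∈ unitCube s, AEStronglyMeasurable (fun t => F (Function.update x i t)) unitMeasure) :
    ∫ x in unitCube s, F x =
      ∫ x in unitCube s, ∫ t in (0 : ℝ)..1, F (Function.update x i t) := by
  rw [integral_merge (Finset.univ.erase i) hF]
  refine setIntegral_congr_fun (measurableSet_unitCube s) fun x hx => ?_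
  have hup : ∀ y : Fin s → ℝ,
      (fun j => if j ∈ Finset.univ.erase i then x j else y j) = Function.update x i (y i) := by
    intro y
    ext j
    by_cases hj : j = i
    · subst hj; simp
    · simp [hj]
  simp only [hup]
  rw [restrict_unitCube, ← integral_unitMeasure]
  exact integral_comp_eval (μ := fun _ : Fin s => unitMeasure) (hFi x hx)

lemma update_mem_closedCube {s : ℕ} {x : Fin s → ℝ} (hx : x ∈ closedCube s) (i : Fin s) {t : ℝ}
    (ht : t ∈ Set.Icc (0 : ℝ) 1) : Function.update x i t ∈ closedCube s := by
  intro j _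
  by_cases hj : j = i
  · subst hj; simpa using ht
  · simpa [hj] using hx j trivial

lemma ContinuousOn.comp_update_closedCube {s : ℕ} {F : (Fin s → ℝ) → ℝ}
    (hF : ContinuousOn F (closedCube s)) {x : Fin s → ℝ} (hx : x ∈ closedCube s) (i : Fin s) :
    ContinuousOn (fun t => F (Function.update x i t)) (Set.Icc 0 1) := by
  have hc : Continuous fun t : ℝ => Function.update x i t :=
    (continuous_const (y := x)).update i continuous_id
  exact hF.comp hc.continuousOn fun _ ht => update_mem_closedCube hx i ht

lemma integrableOn_mul_prod {s : ℕ} {F : (Fin s → ℝ) → ℝ} (hF : ContinuousOn F (closedCube s))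
    {v : Finset (Fin s)} {G : Fin s → ℝ → ℝ} (hG : ∀ j, Measurable (G j)) {C : ℝ}
    (hC : ∀ j x, |G j x| ≤ C) :
    IntegrableOn (fun x => F x * ∏ j ∈ v, G j (x j)) (unitCube s) := by
  refine Integrable.mul_bdd (c := ∏ _j ∈ v, C)
    ((hF.integrableOn_compact (isCompact_closedCube s)).mono_set (unitCube_subset_closedCube s))
    (Finset.measurable_prod _ fun j _ =>
      (hG j).comp (measurable_pi_apply j)).aestronglyMeasurable
    (Filter.Eventually.of_forall fun x => ?_)
  rw [Real.norm_eq_abs, Finset.abs_prod]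
  exact Finset.prod_le_prod (fun _ _ => abs_nonneg _) fun j _ => hC j _

/-- Integration by parts in the `i`-th coordinate against a product kernel. -/
lemma integral_mul_prod_eq_neg {s : ℕ} (i : Fin s) {F F' : (Fin s → ℝ) → ℝ}
    (hF : ContinuousOn F (closedCube s)) (hF' : ContinuousOn F' (closedCube s))
    (hderiv : ∀ x ∈ closedCube s,
      HasDerivWithinAt (fun t => F (Function.update x i t)) (F' x) (Set.Icc 0 1) (x i))
    {G H : Fin s → ℝ → ℝ} (hGm : ∀ j, Measurable (G j)) (hHm : ∀ j, Measurable (H j)) {C : ℝ}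
    (hGC : ∀ j x, |G j x| ≤ C) (hHC : ∀ j x, |H j x| ≤ C) (hne : ∀ j, j ≠ i → H j = G j)
    (hH : ∀ x, 0 ≤ x → H i x = ∫ t in (0 : ℝ)..x, G i t) (hH1 : H i 1 = 0) :
    ∫ x in unitCube s, F x * ∏ j, G j (x j) = -∫ x in unitCube s, F' x * ∏ j, H j (x j) := by
  have hprod : ∀ (K : Fin s → ℝ → ℝ) (x : Fin s → ℝ) (t : ℝ),
      ∏ j, K j (Function.update x i t j) = (∏ j ∈ Finset.univ.erase i, K j (x j)) * K i t := by
    intro K x t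
    rw [← Finset.prod_erase_mul _ _ (Finset.mem_univ i), Function.update_self]
    congr 1
    refine Finset.prod_congr rfl fun j hj => ?_
    rw [Function.update_of_ne (Finset.ne_of_mem_erase hj)]
  have hmeas : ∀ (E : (Fin s → ℝ) → ℝ), ContinuousOn E (closedCube s) →
      ∀ K : Fin s → ℝ → ℝ, (∀ j, Measurable (K j)) → ∀ x ∈ unitCube s,
      AEStronglyMeasurable (fun t => E (Function.update x i t) *
        ∏ j, K j (Function.update x i t j)) unitMeasure := by
    intro E hE K hK x hx
    simp only [hprod]
    refine AEStronglyMeasurable.mul ?_ ((hK i).const_mul _).aestronglyMeasurable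
    exact ((hE.comp_update_closedCube (unitCube_subset_closedCube s hx) i).mono
      Set.Ico_subset_Icc_self).aestronglyMeasurable measurableSet_Ico
  rw [integral_update i (integrableOn_mul_prod hF hGm hGC) (hmeas F hF G hGm),
    integral_update i (integrableOn_mul_prod hF' hHm hHC) (hmeas F' hF' H hHm), ← integral_neg]
  refine setIntegral_congr_fun (measurableSet_unitCube s) fun x hx => ?_
  have hx' := unitCube_subset_closedCube s hx
  have hpe : ∏ j ∈ Finset.univ.erase i, H j (x j) = ∏ j ∈ Finset.univ.erase i, G j (x j) :=
    Finset.prod_congr rfl fun j hj => by rw [hne j (Finset.ne_of_mem_erase hj)]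
  simp only [hprod, hpe, mul_left_comm _ (∏ j ∈ Finset.univ.erase i, G j (x j))]
  rw [intervalIntegral.integral_const_mul, intervalIntegral.integral_const_mul, ← mul_neg]
  congr 1
  refine integral_mul_eq_neg_of_primitive (fun t ht => ?_) (hF'.comp_update_closedCube hx' i)
    (intervalIntegrable_of_measurable_of_abs_le (hGm i) (hGC i) 0 1) (fun t ht => hH t ht.1) hH1
  simpa using hderiv _ (update_mem_closedCube hx' i ht)

/-- Hölder's inequality against a kernel that is controlled in `L¹` and `L^∞`. -/
lemma ofReal_abs_integral_mul_le {α : Type*} [MeasurableSpace α] {μ : Measure α} {P K : α → ℝ}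
    (hP : AEStronglyMeasurable P μ) (hK : Measurable K) {p : ℝ≥0∞} (hp : 1 ≤ p) {A M : ℝ≥0∞}
    (hA : ∀ᵐ x ∂μ, ‖K x‖ₑ ≤ A * M) (hM : ∫⁻ x, ‖K x‖ₑ ∂μ = M) (hM0 : M ≠ 0) (hMt : M ≠ ∞) :
    ENNReal.ofReal |∫ x, P x * K x ∂μ| ≤ A ^ (1 / p.toReal) * M * eLpNorm P p μ := by
  set w := μ.withDensity fun x => ‖K x‖ₑ
  have hwu : w Set.univ = M := by rw [withDensity_apply _ MeasurableSet.univ, setLIntegral_univ, hM]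
  have hle : w ≤ (A * M) • μ := by
    rw [← withDensity_const]
    exact withDensity_mono hA
  have hPw : AEStronglyMeasurable P w := hP.mono_ac (withDensity_absolutelyContinuous _ _)
  have h1 : ENNReal.ofReal |∫ x, P x * K x ∂μ| ≤ eLpNorm P 1 w := by
    rw [← Real.enorm_eq_ofReal_abs, eLpNorm_one_eq_lintegral_enorm]
    refine (enorm_integral_le_lintegral_enorm _).trans_eq ?_
    rw [lintegral_withDensity_eq_lintegral_mul_non_measurable _ hK.enorm
      (Filter.Eventually.of_forall fun x => enorm_lt_top)]
    simp [mul_comm]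
  have hr : (1 / p).toReal = 1 / p.toReal := by simp
  calc ENNReal.ofReal |∫ x, P x * K x ∂μ| ≤ eLpNorm P 1 w := h1
    _ ≤ eLpNorm P p w * M ^ (1 - 1 / p.toReal) := by
        simpa [hwu] using eLpNorm_le_eLpNorm_mul_rpow_measure_univ hp hPw
    _ ≤ ((A * M) ^ (1 / p.toReal) * eLpNorm P p μ) * M ^ (1 - 1 / p.toReal) := by
        gcongr
        refine (eLpNorm_mono_measure P hle).trans ?_
        simpa [hr] using eLpNorm_smul_measure_le (A * M) P p μ
    _ = A ^ (1 / p.toReal) * (M ^ (1 / p.toReal) * M ^ (1 - 1 / p.toReal)) * eLpNorm P p μ := by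
        rw [ENNReal.mul_rpow_of_nonneg _ _ (by positivity)]
        ring
    _ = A ^ (1 / p.toReal) * M * eLpNorm P p μ := by
        rw [← ENNReal.rpow_add _ _ hM0 hMt]
        simp

lemma muW_min_numBits (u k : ℕ) : muW (min u (numBits k)) k = muW u k := by
  rw [muW, muW, numBits, ← List.take_take, List.take_length]

lemma bitsDesc_zero : bitsDesc 0 = [] := rfl

/-- Repeated integration by parts in all coordinates. -/
lemma abs_integral_mul_prod_eq {s : ℕ} {u : Fin s → ℕ} {f : (Fin s → ℝ) → ℝ}
    {D : (Fin s → ℕ) → (Fin s → ℝ) → ℝ} (hf : HasMixedDerivs u f D) {N : Fin s → ℕ}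
    {J : Fin s → ℕ → ℝ → ℝ} {C : ℝ} (hJm : ∀ i, ∀ n ≤ N i, Measurable (J i n))
    (hJC : ∀ i, ∀ n ≤ N i, ∀ x, |J i n x| ≤ C)
    (hJ : ∀ i, ∀ n < N i, ∀ x, 0 ≤ x → J i (n + 1) x = ∫ t in (0 : ℝ)..x, J i n t)
    (hJ1 : ∀ i, ∀ n < N i, J i (n + 1) 1 = 0) {ν : Fin s → ℕ} (hνu : ∀ i, ν i ≤ u i)
    (hνN : ∀ i, ν i ≤ N i) :
    |∫ x in unitCube s, D ν x * ∏ j, J j (ν j) (x j)| =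
      |∫ x in unitCube s, f x * ∏ j, J j 0 (x j)| := by
  obtain ⟨h0, hcont, hder⟩ := hf
  induction hn : ∑ i, ν i generalizing ν with
  | zero =>
    have : ν = fun _ => 0 := funext fun i => by simpa using (Finset.sum_eq_zero_iff.1 hn) i
    subst this
    rw [h0]
  | succ n ih =>
    obtain ⟨i, -, hi⟩ := Finset.exists_ne_zero_of_sum_ne_zero (hn.trans_ne n.succ_ne_zero)
    set ν' := Function.update ν i (ν i - 1) with hν'
    have hself : ν' i = ν i - 1 := by simp [hν']
    have hother : ∀ j, j ≠ i → ν' j = ν j := fun j hj => by simp [hν', hj]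
    have hle : ∀ j, ν' j ≤ ν j := fun j => by
      by_cases hj : j = i
      · subst hj; omega
      · exact (hother j hj).le
    have hadd : addE i ν' = ν := by
      ext j
      by_cases hj : j = i
      · subst hj; simp [addE, hself]; omega
      · simp [addE, hj, hother j hj]
    have hνi : ν i = ν' i + 1 := by omega
    have hlt : ν' i < N i := by have := hνN i; omega
    have hsum : ∑ j, ν' j = n := by
      have h1 := Finset.add_sum_erase _ ν (Finset.mem_univ i)
      have h2 := Finset.add_sum_erase _ ν' (Finset.mem_univ i)
      have h3 : ∑ j ∈ Finset.univ.erase i, ν' j = ∑ j ∈ Finset.univ.erase i, ν j :=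
        Finset.sum_congr rfl fun j hj => hother j (Finset.ne_of_mem_erase hj)
      omega
    rw [← ih (fun j => (hle j).trans (hνu j)) (fun j => (hle j).trans (hνN j)) hsum,
      integral_mul_prod_eq_neg i (hcont ν' fun j => (hle j).trans (hνu j)) (hcont ν hνu)
        (fun x hx => by
          have := hder ν' i (by rw [hadd]; exact hνu) x hx
          rwa [hadd] at this)
        (fun j => hJm j _ ((hle j).trans (hνN j))) (fun j => hJm j _ (hνN j))
        (fun j => hJC j _ ((hle j).trans (hνN j))) (fun j => hJC j _ (hνN j))
        (fun j hj => by rw [hother j hj]) (by rw [hνi]; exact hJ i _ hlt)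
        (by rw [hνi]; exact hJ1 i _ hlt), abs_neg]

lemma ae_unitCube {s : ℕ} {q : (Fin s → ℝ) → Prop} (h : ∀ x ∈ unitCube s, q x) :
    ∀ᵐ x ∂(volume.restrict (unitCube s)), q x :=
  (ae_restrict_iff' (measurableSet_unitCube s)).2 (Filter.Eventually.of_forall h)

lemma merge_mem_unitCube {s : ℕ} (v : Finset (Fin s)) {x y : Fin s → ℝ} (hx : x ∈ unitCube s)
    (hy : y ∈ unitCube s) : (fun i => if i ∈ v then x i else y i) ∈ unitCube s := by
  intro i _
  by_cases hi : i ∈ v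
  · simpa [hi] using hx i trivial
  · simpa [hi] using hy i trivial

lemma memLp_projInt {s : ℕ} (v : Finset (Fin s)) {F : (Fin s → ℝ) → ℝ}
    (hF : ContinuousOn F (closedCube s)) (p : ℝ≥0∞) :
    MemLp (projInt v F) p (volume.restrict (unitCube s)) := by
  obtain ⟨C, hC⟩ := (isCompact_closedCube s).exists_bound_of_continuousOn hF
  have hFm : AEStronglyMeasurable F (volume.restrict (unitCube s)) :=
    (hF.mono (unitCube_subset_closedCube s)).aestronglyMeasurable (measurableSet_unitCube s)
  have hmp := measurePreserving_merge (fun _ : Fin s => unitMeasure) v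
  rw [← restrict_unitCube] at hmp
  refine MemLp.of_bound (C := C)
    (hFm.comp_measurePreserving hmp).integral_prod_right' (ae_unitCube fun x hx => ?_)
  refine (norm_integral_le_of_norm_le_const (C := C) (ae_unitCube fun y hy => ?_)).trans ?_
  · exact hC _ (unitCube_subset_closedCube s (merge_mem_unitCube v hx hy))
  · simp

/-- Lemma `conti_ineq`: for `u ∈ ℕ^s` and `f` with continuous mixed partial
derivatives up to order `u_i` in each variable `x_i`,
`|f̂((k_v;0))| ≤ 2^{|v|/p} ⋅ 2^{-μ'_u((k_v;0))} ⋅ ‖f^{(min(u,N_{k_v}))}‖_p < ∞`. -/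
theorem stmt2 {s : ℕ} (hs : 1 ≤ s) (u : Fin s → ℕ) (hu : ∀ i, 1 ≤ u i)
    (f : (Fin s → ℝ) → ℝ) (D : (Fin s → ℕ) → (Fin s → ℝ) → ℝ)
    (hf : HasMixedDerivs u f D)
    (p : ℝ≥0∞) (hp : 1 ≤ p)
    (v : Finset (Fin s)) (hv : v.Nonempty)
    (k : Fin s → ℕ) (hk : ∀ i, i ∈ v ↔ k i ≠ 0) :
    ENNReal.ofReal |walshCoeff f k| ≤
        (2 : ℝ≥0∞) ^ ((v.card : ℝ) / p.toReal) *
          (2 : ℝ≥0∞) ^ (-(muWV u k : ℝ)) *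
          mixedNorm p v (D fun i => min (u i) (numBits (k i))) ∧
      (2 : ℝ≥0∞) ^ ((v.card : ℝ) / p.toReal) *
          (2 : ℝ≥0∞) ^ (-(muWV u k : ℝ)) *
          mixedNorm p v (D fun i => min (u i) (numBits (k i))) < ∞ := by
  classical
  choose J hJ0 hJ hJs using fun i => exists_walsh_primitives (k i)
  set m : Fin s → ℕ := fun i => min (u i) (numBits (k i))
  have hmN : ∀ i, m i ≤ numBits (k i) := fun i => min_le_right _ _
  have hmu : ∀ i, m i ≤ u i := fun i => min_le_left _ _
  have hcont : ContinuousOn (D m) (closedCube s) := hf.2.1 m hmu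
  have hLp := memLp_projInt v hcont p
  have hJm : ∀ i, Measurable (J i (m i)) := fun i => (hJ i _ (hmN i)).1
  have hJ2 : ∀ i, ∀ n ≤ numBits (k i), ∀ x, |J i n x| ≤ 2 := fun i n hn x =>
    ((hJ i n hn).2.1 x).trans (mul_le_of_le_one_right zero_le_two
      (inv_le_one_of_one_le₀ (one_le_pow₀ one_le_two)))
  have hJv : ∀ i, i ∉ v → ∀ x, 0 ≤ x → J i (m i) x = 1 := by
    intro i hi x hx
    have hki : k i = 0 := by simpa using (hk i).not.1 hi
    have hmi : m i = 0 := by simp [m, hki, numBits, bitsDesc_zero]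
    rw [hmi, hJ0 i x hx, hki]
    simp [walsh]
  set K : (Fin s → ℝ) → ℝ := fun x => ∏ i ∈ v, J i (m i) (x i)
  have hKm : Measurable K :=
    Finset.measurable_prod _ fun i _ => (hJm i).comp (measurable_pi_apply i)
  have hKv : ∀ x ∈ unitCube s, ∏ i, J i (m i) (x i) = K x := fun x hx =>
    (Finset.prod_subset (Finset.subset_univ v) fun i _ hi => hJv i hi _ (hx i trivial).1).symm
  have hint : IntegrableOn (fun x => D m x * K x) (unitCube s) :=
    integrableOn_mul_prod hcont hJm fun i => hJ2 i _ (hmN i)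
  have hcoeff : |walshCoeff f k| = |∫ x in unitCube s, projInt v (D m) x * K x| := by
    have h1 : walshCoeff f k = ∫ x in unitCube s, f x * ∏ i, J i 0 (x i) :=
      setIntegral_congr_fun (measurableSet_unitCube s) fun x hx => by
        simp only [walshV]
        congr 1
        exact Finset.prod_congr rfl fun i _ => (hJ0 i _ (hx i trivial).1).symm
    rw [h1, ← abs_integral_mul_prod_eq hf (fun i n hn => (hJ i n hn).1) hJ2
      (fun i n hn => (hJs i n hn).1) (fun i n hn => (hJs i n hn).2) hmu hmN,
      setIntegral_congr_fun (g := fun x => D m x * K x) (measurableSet_unitCube s)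
        fun x hx => by simp only [hKv x hx],
      integral_merge v hint]
    congr 1
    refine integral_congr_ae (Filter.Eventually.of_forall fun x => ?_)
    have hKx : ∀ y : Fin s → ℝ, K (fun i => if i ∈ v then x i else y i) = K x := fun y =>
      Finset.prod_congr rfl fun i hi => by simp [hi]
    simp only [hKx, projInt]
    exact integral_mul_const _ _
  have hmuW : ∏ i, ((2 : ℝ) ^ muW (m i) (k i))⁻¹ = ((2 : ℝ) ^ muWV u k)⁻¹ := by
    simp only [m, muW_min_numBits, muWV]
    rw [Finset.prod_inv_distrib, Finset.prod_pow_eq_pow_sum]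
  have hmuWv : ∏ i ∈ v, ((2 : ℝ) ^ muW (m i) (k i))⁻¹ = ((2 : ℝ) ^ muWV u k)⁻¹ := by
    rw [← hmuW]
    refine Finset.prod_subset (Finset.subset_univ v) fun i _ hi => ?_
    have hki : k i = 0 := by simpa using (hk i).not.1 hi
    simp [hki, muW, bitsDesc_zero]
  have hM : (2 : ℝ≥0∞) ^ (-(muWV u k : ℝ)) = ENNReal.ofReal ((2 : ℝ) ^ muWV u k)⁻¹ := by
    rw [ENNReal.rpow_neg, ENNReal.rpow_natCast, ENNReal.ofReal_inv_of_pos (by positivity),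
      ENNReal.ofReal_pow zero_le_two, ENNReal.ofReal_ofNat]
  have hKsup : ∀ x, ‖K x‖ₑ ≤ 2 ^ v.card * (2 : ℝ≥0∞) ^ (-(muWV u k : ℝ)) := by
    intro x
    have h1 : |K x| ≤ 2 ^ v.card * ((2 : ℝ) ^ muWV u k)⁻¹ := by
      rw [← hmuWv, Finset.abs_prod, ← Finset.prod_const, ← Finset.prod_mul_distrib]
      exact Finset.prod_le_prod (fun _ _ => abs_nonneg _) fun i _ => (hJ i _ (hmN i)).2.1 _
    rw [hM, Real.enorm_eq_ofReal_abs]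
    refine (ENNReal.ofReal_le_ofReal h1).trans_eq ?_
    rw [ENNReal.ofReal_mul (by positivity), ENNReal.ofReal_pow zero_le_two, ENNReal.ofReal_ofNat]
  have hKint : ∫⁻ x in unitCube s, ‖K x‖ₑ = (2 : ℝ≥0∞) ^ (-(muWV u k : ℝ)) := by
    have hKi : IntegrableOn K (unitCube s) := by
      simpa using integrableOn_mul_prod (v := v) (F := fun _ => 1) continuousOn_const hJm
        fun i => hJ2 i _ (hmN i)
    rw [hM, ← hmuW, ← ofReal_integral_norm_eq_lintegral_enorm hKi]
    congr 1
    calc ∫ x in unitCube s, ‖K x‖ = ∫ x in unitCube s, ∏ i, |J i (m i) (x i)| :=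
          setIntegral_congr_fun (measurableSet_unitCube s) fun x hx => by
            simp only [← hKv x hx, Real.norm_eq_abs, Finset.abs_prod]
      _ = ∏ i, ∫ x, |J i (m i) x| ∂unitMeasure := by
          rw [restrict_unitCube]
          exact integral_fintype_prod_eq_prod (fun i x => |J i (m i) x|)
      _ = ∏ i, ((2 : ℝ) ^ muW (m i) (k i))⁻¹ :=
          Finset.prod_congr rfl fun i _ => by
            rw [integral_unitMeasure]; exact (hJ i _ (hmN i)).2.2
  have hMt : (2 : ℝ≥0∞) ^ (-(muWV u k : ℝ)) ≠ ∞ := by rw [hM]; exact ENNReal.ofReal_ne_top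
  refine ⟨?_, ?_⟩
  · have := ofReal_abs_integral_mul_le hLp.1 hKm hp (Filter.Eventually.of_forall hKsup) hKint
      (by rw [hM]; exact (ENNReal.ofReal_pos.2 (by positivity)).ne') hMt
    rw [hcoeff]
    rwa [← ENNReal.rpow_natCast, ← ENNReal.rpow_mul, mul_one_div] at this
  · exact ENNReal.mul_lt_top (ENNReal.mul_lt_top
      (ENNReal.rpow_lt_top_of_nonneg (by positivity) ENNReal.ofNat_ne_top) hMt.lt_top) hLp.2

end
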